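/- arXiv:1508.06616 — 8 statements merged into one kernel-verified Lean document; each statement's English description precedes it below -/
import Mathlib

section
/- Every invertible complex matrix can be written as a product of two invertible diagonalizable matrices each having distinct eigenvalues: for every natural number n ≥ 1 and every B ∈ GL(n, ℂ), there exist C₁, C₂ ∈ GL(n, ℂ) with B = C₁·C₂ such that the characteristic polynomial of C₁ has n distinct roots and the characteristic polynomial of C₂ has n distinct roots (in particular C₁ and C₂ are diagonalizable). -/
open Polynomial in
/-- Having a separable characteristic polynomial is a Zariski open condition along a
one-parameter polynomial family of complex matrices. -/
theorem exists_ne_zero_forall_eval_ne_zero_charpoly_separable {n : ℕ}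
    (M : Matrix (Fin n) (Fin n) ℂ[X]) (a : ℂ)
    (h : ((evalRingHom a).mapMatrix M).charpoly.Separable) :
    ∃ p : ℂ[X], p ≠ 0 ∧
      ∀ t, p.eval t ≠ 0 → ((evalRingHom t).mapMatrix M).charpoly.Separable := by
  have key (t : ℂ) : (resultant M.charpoly (derivative M.charpoly)).eval t =
      resultant ((evalRingHom t).mapMatrix M).charpoly
        (derivative ((evalRingHom t).mapMatrix M).charpoly) := by
    have hmap : ((evalRingHom t).mapMatrix M).charpoly = M.charpoly.map (evalRingHom t) :=
      Matrix.charpoly_map M (evalRingHom t)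
    have hdeg : (M.charpoly.map (evalRingHom t)).natDegree = M.charpoly.natDegree :=
      M.charpoly_monic.natDegree_map _
    rw [hmap, natDegree_derivative, natDegree_derivative, hdeg, derivative_map,
      resultant_map_map, coe_evalRingHom]
  refine ⟨resultant M.charpoly (derivative M.charpoly), fun h0 ↦ ?_, fun t ht ↦ ?_⟩
  · exact resultant_ne_zero _ _ h (by rw [← key, h0, eval_zero])
  · rw [key] at ht
    exact (isUnit_resultant_iff_isCoprime (Matrix.charpoly_monic _)).1 ht.isUnit

theorem Matrix.card_toFinset_roots_charpoly_of_separable {n : ℕ} {A : Matrix (Fin n) (Fin n) ℂ}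
    (h : A.charpoly.Separable) : A.charpoly.roots.toFinset.card = n := by
  rw [Multiset.toFinset_card_of_nodup (Polynomial.nodup_roots h),
    ← (IsAlgClosed.splits A.charpoly).natDegree_eq_card_roots, A.charpoly_natDegree_eq_dim,
    Fintype.card_fin]

theorem Matrix.card_toFinset_roots_charpoly_eq_ncard_spectrum {n : ℕ}
    (A : Matrix (Fin n) (Fin n) ℂ) :
    A.charpoly.roots.toFinset.card = (spectrum ℂ A).ncard := by
  rw [← Set.ncard_coe_finset]
  congr 1
  ext x
  simp [Matrix.mem_spectrum_iff_isRoot_charpoly, A.charpoly_monic.ne_zero]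

theorem Matrix.GeneralLinearGroup.card_toFinset_roots_charpoly_inv {n : ℕ}
    (A : GL (Fin n) ℂ) :
    ((A⁻¹ : GL (Fin n) ℂ) : Matrix (Fin n) (Fin n) ℂ).charpoly.roots.toFinset.card =
      (A : Matrix (Fin n) (Fin n) ℂ).charpoly.roots.toFinset.card := by
  rw [Matrix.card_toFinset_roots_charpoly_eq_ncard_spectrum,
    Matrix.card_toFinset_roots_charpoly_eq_ncard_spectrum, ← spectrum.map_inv, Set.ncard_inv]

open Polynomial in
/-- Every invertible complex matrix can be written as a product of two
invertible diagonalizable matrices each having distinct eigenvalues (i.e. the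
characteristic polynomial has `n` distinct roots). -/
theorem decomposition_into_two_matrices_with_distinct_eigenvalues
    (n : ℕ) (hn : 1 ≤ n) (B : GL (Fin n) ℂ) :
    ∃ C₁ C₂ : GL (Fin n) ℂ, B = C₁ * C₂ ∧
      ((C₁ : Matrix (Fin n) (Fin n) ℂ).charpoly.roots.toFinset.card = n) ∧
      ((C₂ : Matrix (Fin n) (Fin n) ℂ).charpoly.roots.toFinset.card = n) := by
  let D : Matrix (Fin n) (Fin n) ℂ := Matrix.diagonal fun i ↦ ((i : ℕ) : ℂ) + 1
  have hD : D.charpoly.Separable := by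
    rw [Matrix.charpoly_diagonal, separable_prod_X_sub_C_iff]
    intro i j hij
    simpa [Fin.ext_iff] using hij
  have hDdet : D.det ≠ 0 := by
    rw [Matrix.det_diagonal]
    exact Finset.prod_ne_zero_iff.2 fun i _ ↦ Nat.cast_add_one_ne_zero _
  -- the line through `D` and `B * D`
  let P : Matrix (Fin n) (Fin n) ℂ[X] :=
    C.mapMatrix D + (X : ℂ[X]) • C.mapMatrix (B.1 * D - D)
  have hP (t : ℂ) : (evalRingHom t).mapMatrix P = D + t • (B.1 * D - D) := by
    ext i j
    simp [P]
  let Q : Matrix (Fin n) (Fin n) ℂ[X] := C.mapMatrix (B⁻¹).1 * P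
  have hQ (t : ℂ) : (evalRingHom t).mapMatrix Q = (B⁻¹).1 * (evalRingHom t).mapMatrix P := by
    rw [map_mul]
    congr 1
    ext i j
    simp
  obtain ⟨p, hp, hpP⟩ := exists_ne_zero_forall_eval_ne_zero_charpoly_separable P 0
    (by rw [hP, zero_smul, add_zero]; exact hD)
  obtain ⟨q, hq, hqQ⟩ := exists_ne_zero_forall_eval_ne_zero_charpoly_separable Q 1
    (by rw [hQ, hP, one_smul, add_sub_cancel, ← mul_assoc, ← Units.val_mul, inv_mul_cancel,
          Units.val_one, one_mul]; exact hD)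
  have hdet : P.det ≠ 0 := fun h ↦ hDdet <| by
    have h0 := RingHom.map_det (evalRingHom (0 : ℂ)) P
    rwa [hP, h, map_zero, zero_smul, add_zero, eq_comm] at h0
  obtain ⟨t, ht⟩ : ∃ t, (P.det * p * q).eval t ≠ 0 := by
    by_contra! h
    exact mul_ne_zero (mul_ne_zero hdet hp) hq (funext fun t ↦ by rw [h, eval_zero])
  rw [eval_mul, eval_mul, mul_ne_zero_iff, mul_ne_zero_iff] at ht
  obtain ⟨⟨htdet, htp⟩, htq⟩ := ht
  have hunit : ((evalRingHom t).mapMatrix P).det ≠ 0 := by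
    rwa [← RingHom.map_det]
  let A : GL (Fin n) ℂ := Matrix.GeneralLinearGroup.mkOfDetNeZero _ hunit
  refine ⟨A, (B⁻¹ * A)⁻¹, by group,
    Matrix.card_toFinset_roots_charpoly_of_separable (hpP t htp), ?_⟩
  rw [Matrix.GeneralLinearGroup.card_toFinset_roots_charpoly_inv]
  apply Matrix.card_toFinset_roots_charpoly_of_separable
  have h := hqQ t htq
  rwa [hQ] at h
end

section
/- For every natural number n ≥ 1 and every B ∈ GL(n, ℂ), the set of matrices C ∈ GL(n, ℂ) such that both C and C⁻¹·B have characteristic polynomial with n distinct roots is open and dense in GL(n, ℂ). -/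
/-- A matrix has `n` distinct eigenvalues when its characteristic polynomial has
`n` distinct complex roots. -/
def HasDistinctEigenvalues (n : ℕ) (M : Matrix (Fin n) (Fin n) ℂ) : Prop :=
  M.charpoly.roots.toFinset.card = n

open Polynomial in
/-- The discriminant of the characteristic polynomial, as a polynomial in the matrix entries
(up to sign). -/
noncomputable def charpolyDiscr (n : ℕ) : MvPolynomial (Fin n × Fin n) ℂ :=
  resultant (Matrix.charpoly.univ ℂ (Fin n)) (derivative (Matrix.charpoly.univ ℂ (Fin n))) n (n - 1)

lemma hasDistinctEigenvalues_iff_separable {n : ℕ} (M : Matrix (Fin n) (Fin n) ℂ) :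
    HasDistinctEigenvalues n M ↔ M.charpoly.Separable := by
  have hsplits := IsAlgClosed.splits M.charpoly
  rw [← Polynomial.nodup_roots_iff_of_splits M.charpoly_monic.ne_zero hsplits,
    ← Multiset.toFinset_card_eq_card_iff_nodup, ← hsplits.natDegree_eq_card_roots,
    M.charpoly_natDegree_eq_dim, Fintype.card_fin, HasDistinctEigenvalues]

lemma hasDistinctEigenvalues_iff_eval_charpolyDiscr_ne_zero {n : ℕ}
    (M : Matrix (Fin n) (Fin n) ℂ) :
    HasDistinctEigenvalues n M ↔
      MvPolynomial.eval (fun p ↦ M p.1 p.2) (charpolyDiscr n) ≠ 0 := by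
  have hmap : (Matrix.charpoly.univ ℂ (Fin n)).map (MvPolynomial.eval fun p ↦ M p.1 p.2) =
      M.charpoly :=
    Matrix.charpoly.univ_map_eval₂Hom (Fin n) (RingHom.id ℂ) fun p ↦ M p.1 p.2
  have hdeg : M.charpoly.natDegree = n := by simp
  have hdeg' : (Polynomial.derivative M.charpoly).natDegree = n - 1 := by
    rw [Polynomial.natDegree_derivative, hdeg]
  have hunit := Polynomial.isUnit_resultant_iff_isCoprime (g := Polynomial.derivative M.charpoly)
    M.charpoly_monic
  rw [hdeg, hdeg'] at hunit
  rw [hasDistinctEigenvalues_iff_separable, Polynomial.Separable, ← hunit, charpolyDiscr,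
    ← Polynomial.resultant_map_map, ← Polynomial.derivative_map, hmap, isUnit_iff_ne_zero]

lemma hasDistinctEigenvalues_diagonal {n : ℕ} {d : Fin n → ℂ} (hd : Function.Injective d) :
    HasDistinctEigenvalues n (Matrix.diagonal d) := by
  rw [hasDistinctEigenvalues_iff_separable, Matrix.charpoly_diagonal]
  exact Polynomial.separable_prod_X_sub_C_iff.2 hd

lemma isOpen_setOf_hasDistinctEigenvalues (n : ℕ) :
    IsOpen {M : Matrix (Fin n) (Fin n) ℂ | HasDistinctEigenvalues n M} := by
  simp only [hasDistinctEigenvalues_iff_eval_charpolyDiscr_ne_zero]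
  refine isOpen_ne.preimage ((MvPolynomial.continuous_eval (charpolyDiscr n)).comp ?_)
  fun_prop

/-- The nonvanishing locus of a nonzero polynomial function is dense. -/
lemma MvPolynomial.dense_setOf_eval_ne_zero {σ : Type*} [Fintype σ] {p : MvPolynomial σ ℂ}
    {y : σ → ℂ} (hy : eval y p ≠ 0) : Dense {x | eval x p ≠ 0} := by
  rw [← Set.compl_ofPred, ← interior_eq_empty_iff_dense_compl, Set.eq_empty_iff_forall_notMem]
  intro z hz
  have h := AnalyticOnNhd.eqOn_zero_of_preconnected_of_eventuallyEq_zero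
    (AnalyticOnNhd.eval_mvPolynomial p) isPreconnected_univ (Set.mem_univ z)
    (mem_interior_iff_mem_nhds.1 hz)
  exact hy (h (Set.mem_univ y))

lemma dense_setOf_hasDistinctEigenvalues (n : ℕ) :
    Dense {M : Matrix (Fin n) (Fin n) ℂ | HasDistinctEigenvalues n M} := by
  have hy := (hasDistinctEigenvalues_iff_eval_charpolyDiscr_ne_zero _).1
    (hasDistinctEigenvalues_diagonal (d := fun i : Fin n ↦ ((i : ℕ) : ℂ))
      (Nat.cast_injective.comp Fin.val_injective))
  have hcurry : Continuous fun (x : Fin n × Fin n → ℂ) ↦ Matrix.of x.curry :=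
    continuous_matrix fun i j ↦ continuous_apply (i, j)
  have hsurj : Function.Surjective fun (x : Fin n × Fin n → ℂ) ↦ Matrix.of x.curry :=
    fun M ↦ ⟨fun p ↦ M p.1 p.2, rfl⟩
  refine (hsurj.denseRange.dense_image hcurry
    (MvPolynomial.dense_setOf_eval_ne_zero hy)).mono ?_
  rintro _ ⟨x, hx, rfl⟩
  exact (hasDistinctEigenvalues_iff_eval_charpolyDiscr_ne_zero _).2 hx

lemma Matrix.GeneralLinearGroup.isOpenMap_val (n : Type*) [Fintype n] [DecidableEq n] :
    IsOpenMap (Units.val : GL n ℂ → Matrix n n ℂ) :=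
  letI := Matrix.linftyOpNormedRing (n := n) (α := ℂ)
  letI := Matrix.linftyOpNormedAlgebra (n := n) (R := ℂ) (α := ℂ)
  haveI : @CompleteSpace (Matrix n n ℂ) PseudoMetricSpace.toUniformSpace :=
    FiniteDimensional.complete ℂ _
  Units.isOpenMap_val

/-- For every `n ≥ 1` and `B ∈ GL(n, ℂ)`, the set of `C ∈ GL(n, ℂ)` such
that both `C` and `C⁻¹·B` have characteristic polynomial with `n` distinct roots is
open and dense in `GL(n, ℂ)`. -/
theorem isOpen_and_dense_good_factors (n : ℕ) (hn : 1 ≤ n) (B : GL (Fin n) ℂ) :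
    IsOpen {C : GL (Fin n) ℂ |
        HasDistinctEigenvalues n (C : Matrix (Fin n) (Fin n) ℂ) ∧
        HasDistinctEigenvalues n ((C⁻¹ * B : GL (Fin n) ℂ) : Matrix (Fin n) (Fin n) ℂ)} ∧
    Dense {C : GL (Fin n) ℂ |
        HasDistinctEigenvalues n (C : Matrix (Fin n) (Fin n) ℂ) ∧
        HasDistinctEigenvalues n ((C⁻¹ * B : GL (Fin n) ℂ) : Matrix (Fin n) (Fin n) ℂ)} := by
  have hopen : IsOpen {C : GL (Fin n) ℂ | HasDistinctEigenvalues n C.val} :=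
    (isOpen_setOf_hasDistinctEigenvalues n).preimage Units.continuous_val
  have hdense : Dense {C : GL (Fin n) ℂ | HasDistinctEigenvalues n C.val} :=
    (dense_setOf_hasDistinctEigenvalues n).preimage
      (Matrix.GeneralLinearGroup.isOpenMap_val (Fin n))
  let e : GL (Fin n) ℂ ≃ₜ GL (Fin n) ℂ := (Homeomorph.inv _).trans (Homeomorph.mulRight B)
  have hopen' := hopen.preimage e.continuous
  exact ⟨hopen.inter hopen', hdense.inter_of_isOpen_left (hdense.preimage e.isOpenMap) hopen⟩
end

section
/- Rigidity of diagonal conjugation forces decomposability: let n ≥ 1, let 𝓑 be a set of n×n complex matrices, and let D = diag(d₁,…,dₙ) and D′ = diag(d₁′,…,dₙ′) be invertible diagonal matrices with d₁ = d₁′ and D ≠ D′ such that D·B·D⁻¹ = D′·B·(D′)⁻¹ for every B ∈ 𝓑. Then, setting I = { i : dᵢ = dᵢ′ } and I′ = { i : dᵢ ≠ dᵢ′ }, both I and I′ are nonempty, and every B ∈ 𝓑 satisfies Bᵢⱼ = 0 whenever i ∈ I and j ∈ I′, and also whenever i ∈ I′ and j ∈ I. -/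
/-- Conjugation of `B` by an invertible diagonal matrix scales `B i j` by `d i / d j`. -/
theorem Matrix.diagonal_mul_mul_inv_diagonal_apply {ι K : Type*} [Fintype ι] [DecidableEq ι]
    [Field K] {d : ι → K} (hd : ∀ i, d i ≠ 0) (B : Matrix ι ι K) (i j : ι) :
    (Matrix.diagonal d * B * (Matrix.diagonal d)⁻¹) i j = d i * B i j * (d j)⁻¹ := by
  have hinv : (Matrix.diagonal d)⁻¹ = Matrix.diagonal fun k => (d k)⁻¹ :=
    Matrix.inv_eq_right_inv (by simp [Matrix.diagonal_mul_diagonal, hd])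
  rw [hinv, Matrix.mul_diagonal, Matrix.diagonal_mul]

/-- Rigidity of diagonal conjugation forces decomposability.  If two
invertible diagonal matrices `D = diagonal d`, `D' = diagonal d'` with `d₁ = d₁′`
and `D ≠ D'` conjugate every member of the family `𝓑` in the same way, then the
index sets `I = {i | dᵢ = dᵢ′}` and `I′ = {i | dᵢ ≠ dᵢ′}` are both nonempty and
every `B ∈ 𝓑` vanishes on `(I×I′) ∪ (I′×I)`. -/
theorem diagonal_conjugation_rigidity_forces_decomposability
    (n : ℕ) (hn : 1 ≤ n) (𝓑 : Set (Matrix (Fin n) (Fin n) ℂ))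
    (d d' : Fin n → ℂ) (hd : ∀ i, d i ≠ 0) (hd' : ∀ i, d' i ≠ 0)
    (hfirst : d ⟨0, hn⟩ = d' ⟨0, hn⟩)
    (hne : Matrix.diagonal d ≠ Matrix.diagonal d')
    (hconj : ∀ B ∈ 𝓑,
      Matrix.diagonal d * B * (Matrix.diagonal d)⁻¹ =
      Matrix.diagonal d' * B * (Matrix.diagonal d')⁻¹) :
    ({i : Fin n | d i = d' i}).Nonempty ∧ ({i : Fin n | d i ≠ d' i}).Nonempty ∧
    ∀ B ∈ 𝓑, ∀ i j : Fin n,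
      ((i ∈ {i : Fin n | d i = d' i} ∧ j ∈ {i : Fin n | d i ≠ d' i}) ∨
       (i ∈ {i : Fin n | d i ≠ d' i} ∧ j ∈ {i : Fin n | d i = d' i})) → B i j = 0 := by
  refine ⟨⟨⟨0, hn⟩, hfirst⟩, ?_, ?_⟩
  · exact Function.ne_iff.mp fun h => hne (congrArg Matrix.diagonal h)
  · intro B hB i j hij
    have hentry := congrFun (congrFun (hconj B hB) i) j
    rw [Matrix.diagonal_mul_mul_inv_diagonal_apply hd,
      Matrix.diagonal_mul_mul_inv_diagonal_apply hd', ← div_eq_mul_inv, ← div_eq_mul_inv,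
      div_eq_div_iff (hd j) (hd' j)] at hentry
    simp only [Set.mem_ofPred_eq] at hij
    by_contra hBij
    have hcross : d i * d' j = d' i * d j :=
      mul_right_cancel₀ hBij (by linear_combination hentry)
    rcases hij with ⟨hi, hj⟩ | ⟨hi, hj⟩
    · rw [hi] at hcross
      exact hj (mul_left_cancel₀ (hd' i) hcross).symm
    · rw [hj] at hcross
      exact hi (mul_right_cancel₀ (hd' j) hcross)
end

section
/- Exponential decay of off-diagonal entries under a spectral gap: let n ≥ 1, let Λ : ℝ → Matₙ(ℂ) be continuous and diagonal with diagonal entries λ₁(t),…,λₙ(t), let β > 0, and suppose Re(λᵢ(t) − λⱼ(t)) ≥ β for all i < j and all t ≤ 0. Let N : ℝ → Matₙ(ℂ) be differentiable with N′(t) = Λ(t)·N(t) − N(t)·Λ(t). Then for all i < j and all t ≤ 0, one has |Nᵢⱼ(t)| ≤ |Nᵢⱼ(0)| · exp(β t). -/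
/-- A solution of the scalar equation `f′ = μ f` with `β ≤ Re μ` on `(-∞, 0]` decays at least
like `exp (β t)` as `t → -∞`. -/
theorem norm_le_norm_zero_mul_exp_of_hasDerivAt_mul {f μ : ℝ → ℂ} {β : ℝ}
    (hf : ∀ t ≤ 0, HasDerivAt f (μ t * f t) t) (hμ : ∀ t ≤ 0, β ≤ (μ t).re)
    {t : ℝ} (ht : t ≤ 0) : ‖f t‖ ≤ ‖f 0‖ * Real.exp (β * t) := by
  have hinner (s : ℝ) : inner ℝ (f s) (μ s * f s) = (μ s).re * ‖f s‖ ^ 2 := by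
    rw [Complex.inner, mul_assoc, Complex.mul_conj, Complex.re_mul_ofReal,
      Complex.normSq_eq_norm_sq]
  have hderiv (s : ℝ) (hs : s ≤ 0) :
      HasDerivAt (fun s => ‖f s‖ ^ 2 * Real.exp (-(2 * β) * s))
        (2 * ((μ s).re - β) * ‖f s‖ ^ 2 * Real.exp (-(2 * β) * s)) s := by
    have hexp := ((hasDerivAt_id s).const_mul (-(2 * β))).exp
    refine ((hf s hs).norm_sq.mul hexp).congr_deriv ?_
    rw [hinner]
    simp only [id]
    ring
  have hmono : MonotoneOn (fun s => ‖f s‖ ^ 2 * Real.exp (-(2 * β) * s)) (Set.Iic 0) := by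
    refine monotoneOn_of_hasDerivWithinAt_nonneg (convex_Iic 0)
      (fun s hs => (hderiv s hs).continuousAt.continuousWithinAt)
      (fun s hs => (hderiv s (Set.mem_Iic.1 (interior_subset hs))).hasDerivWithinAt) fun s hs => ?_
    have := sub_nonneg.2 (hμ s (Set.mem_Iic.1 (interior_subset hs)))
    positivity
  have hle : ‖f t‖ ^ 2 * Real.exp (-(2 * β) * t) ≤ ‖f 0‖ ^ 2 := by
    simpa using hmono ht Set.self_mem_Iic ht
  refine (sq_le_sq₀ (by positivity) (by positivity)).1 ?_
  calc ‖f t‖ ^ 2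
      = ‖f t‖ ^ 2 * Real.exp (-(2 * β) * t) * Real.exp (β * t) ^ 2 := by
        rw [← Real.exp_nat_mul, mul_assoc, ← Real.exp_add]
        ring_nf
        simp
    _ ≤ ‖f 0‖ ^ 2 * Real.exp (β * t) ^ 2 := by gcongr
    _ = (‖f 0‖ * Real.exp (β * t)) ^ 2 := by ring

/-- Exponential decay of off-diagonal entries under a spectral gap.
If `Re(λᵢ(t) − λⱼ(t)) ≥ β > 0` for `i < j` and `t ≤ 0`, and
`N′(t) = Λ(t)·N(t) − N(t)·Λ(t)` with `Λ(t) = diag(λ₁(t),…,λₙ(t))`, then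
`|Nᵢⱼ(t)| ≤ |Nᵢⱼ(0)| · exp(β t)` for `i < j` and `t ≤ 0`. -/
theorem offdiagonal_exponential_decay_under_spectral_gap
    (n : ℕ) (hn : 1 ≤ n) (l : Fin n → ℝ → ℂ) (hl : ∀ i, Continuous (l i))
    (β : ℝ) (hβ : 0 < β)
    (hgap : ∀ i j : Fin n, i < j → ∀ t : ℝ, t ≤ 0 → β ≤ (l i t - l j t).re)
    (N : ℝ → Matrix (Fin n) (Fin n) ℂ)
    (hN : ∀ (i j : Fin n) (t : ℝ), HasDerivAt (fun s => N s i j)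
      ((Matrix.diagonal (fun i => l i t) * N t
        - N t * Matrix.diagonal (fun i => l i t)) i j) t) :
    ∀ i j : Fin n, i < j → ∀ t : ℝ, t ≤ 0 →
      ‖N t i j‖ ≤ ‖N 0 i j‖ * Real.exp (β * t) := by
  intro i j hij t ht
  refine norm_le_norm_zero_mul_exp_of_hasDerivAt_mul (f := fun s => N s i j)
    (fun s _ => (hN i j s).congr_deriv ?_) (hgap i j hij) ht
  rw [Matrix.sub_apply, Matrix.diagonal_mul, Matrix.mul_diagonal]
  ring
end

section
/- Exponential lower bound on the approach of a trajectory to a singular point: let p : ℂ → ℂ be continuous, let x₀ ∈ ℂ, a > 0, δ > 0, and suppose Re( p(z)/(z − x₀) ) > −a for all z with 0 < |z − x₀| < δ. Let t₀ ∈ ℝ and let x : [t₀, ∞) → ℂ be differentiable with x′(t) = p(x(t)) and 0 < |x(t) − x₀| < δ for all t ≥ t₀. Then for all t ≥ t₀, |x(t) − x₀| ≥ |x(t₀) − x₀| · exp(−a (t − t₀)). -/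
/-- If `⟪w, w'⟫ ≥ -a ‖w‖²` along a differentiable curve `w` on `[t₀, ∞)`, then `‖w‖` decays at most
like `exp (-a (t - t₀))`. -/
theorem norm_mul_exp_le_norm_of_neg_mul_sq_le_inner_deriv {E : Type*} [NormedAddCommGroup E]
    [InnerProductSpace ℝ E] {w w' : ℝ → E} {a t₀ : ℝ}
    (hw : ∀ t, t₀ ≤ t → HasDerivAt w (w' t) t)
    (h : ∀ t, t₀ ≤ t → -a * ‖w t‖ ^ 2 ≤ inner ℝ (w t) (w' t)) {t : ℝ} (ht : t₀ ≤ t) :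
    ‖w t₀‖ * Real.exp (-a * (t - t₀)) ≤ ‖w t‖ := by
  have hderiv (s : ℝ) (hs : t₀ ≤ s) :
      HasDerivAt (fun s ↦ ‖w s‖ ^ 2 * Real.exp (a * (s - t₀)) ^ 2)
        (2 * (inner ℝ (w s) (w' s) + a * ‖w s‖ ^ 2) * Real.exp (a * (s - t₀)) ^ 2) s := by
    refine ((hw s hs).norm_sq.mul
      ((((hasDerivAt_id s).sub_const t₀).const_mul a).exp.pow 2)).congr_deriv ?_
    simp only [id_eq, Pi.pow_apply]
    push_cast
    ring
  have hmono : MonotoneOn (fun s ↦ ‖w s‖ ^ 2 * Real.exp (a * (s - t₀)) ^ 2) (Set.Ici t₀) := by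
    refine monotoneOn_of_hasDerivWithinAt_nonneg (convex_Ici t₀)
      (fun s hs ↦ (hderiv s hs).continuousAt.continuousWithinAt)
      (fun s hs ↦ (hderiv s (interior_subset hs)).hasDerivWithinAt) fun s hs ↦ ?_
    have := h s (interior_subset hs)
    have : 0 ≤ inner ℝ (w s) (w' s) + a * ‖w s‖ ^ 2 := by linarith
    positivity
  have hle : ‖w t₀‖ ^ 2 ≤ (‖w t‖ * Real.exp (a * (t - t₀))) ^ 2 := by
    simpa [mul_pow] using hmono Set.self_mem_Ici ht ht
  rw [neg_mul, Real.exp_neg, ← div_eq_mul_inv, div_le_iff₀ (Real.exp_pos _)]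
  exact le_of_sq_le_sq hle (by positivity)

theorem Complex.inner_eq_re_div_mul_sq_norm {w : ℂ} (v : ℂ) (hw : w ≠ 0) :
    inner ℝ w v = (v / w).re * ‖w‖ ^ 2 := by
  obtain ⟨q, rfl⟩ : ∃ q, v = q * w := ⟨v / w, (div_mul_cancel₀ v hw).symm⟩
  rw [mul_div_cancel_right₀ q hw, Complex.inner, mul_assoc, Complex.mul_conj,
    Complex.re_mul_ofReal, Complex.normSq_eq_norm_sq]

/-- Exponential lower bound on the approach of a trajectory of
`ẋ = p(x)` to a singular point `x₀`: if `Re(p(z)/(z − x₀)) > −a` on the punctured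
disk of radius `δ` around `x₀`, and the trajectory stays in that punctured disk for
`t ≥ t₀`, then `|x(t) − x₀| ≥ |x(t₀) − x₀| · exp(−a(t − t₀))`. -/
theorem trajectory_exponential_lower_bound
    (p : ℂ → ℂ) (hp : Continuous p) (x₀ : ℂ) (a δ : ℝ) (ha : 0 < a) (hδ : 0 < δ)
    (hre : ∀ z : ℂ, 0 < ‖z - x₀‖ → ‖z - x₀‖ < δ → -a < (p z / (z - x₀)).re)
    (t₀ : ℝ) (x : ℝ → ℂ)
    (hx : ∀ t, t₀ ≤ t → HasDerivAt x (p (x t)) t)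
    (hxin : ∀ t, t₀ ≤ t → 0 < ‖x t - x₀‖ ∧ ‖x t - x₀‖ < δ) :
    ∀ t, t₀ ≤ t → ‖x t₀ - x₀‖ * Real.exp (-a * (t - t₀)) ≤ ‖x t - x₀‖ := by
  refine fun t ht ↦ norm_mul_exp_le_norm_of_neg_mul_sq_le_inner_deriv
    (w := fun s ↦ x s - x₀) (fun s hs ↦ (hx s hs).sub_const x₀) (fun s hs ↦ ?_) ht
  obtain ⟨hpos, hlt⟩ := hxin s hs
  rw [Complex.inner_eq_re_div_mul_sq_norm _ (norm_pos_iff.mp hpos)]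
  gcongr
  exact (hre _ hpos hlt).le
end

section
/- Exponential lower bound on the vector field along a trajectory: let p : ℂ → ℂ be continuous, let x₀ ∈ ℂ, a > 0, δ > 0, c > 0 and k a natural number, and suppose Re( p(z)/(z − x₀) ) > −a and |p(z)| ≥ c·|z − x₀|^{k+1} for all z with 0 < |z − x₀| < δ. Let t₀ ∈ ℝ and let x : [t₀, ∞) → ℂ be differentiable with x′(t) = p(x(t)) and 0 < |x(t) − x₀| < δ for all t ≥ t₀. Then for all t ≥ t₀, |p(x(t))| ≥ c · |x(t₀) − x₀|^{k+1} · exp(−(k+1) a (t − t₀)). -/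
theorem Complex.inner_eq_norm_sq_mul_re_div {w : ℂ} (hw : w ≠ 0) (v : ℂ) :
    inner ℝ w v = ‖w‖ ^ 2 * (v / w).re := by
  have h : Complex.normSq w ≠ 0 := by simpa using hw
  rw [Complex.inner, Complex.div_re, ← Complex.normSq_eq_norm_sq]
  field_simp
  simp

/-- A nonvanishing complex curve whose logarithmic derivative has real part at least `-a`
decays in norm no faster than `exp (-a t)`. -/
theorem Complex.norm_mul_exp_le_norm_of_neg_le_re_div {f f' : ℝ → ℂ} {a t₀ : ℝ}
    (hf : ∀ t, t₀ ≤ t → HasDerivAt f (f' t) t) (hf₀ : ∀ t, t₀ ≤ t → f t ≠ 0)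
    (hre : ∀ t, t₀ ≤ t → -a ≤ (f' t / f t).re) {t : ℝ} (ht : t₀ ≤ t) :
    ‖f t₀‖ * Real.exp (-a * (t - t₀)) ≤ ‖f t‖ := by
  have hderiv (s : ℝ) (hs : t₀ ≤ s) :
      HasDerivAt (fun s ↦ ‖f s‖ ^ 2 * Real.exp (2 * a * (s - t₀)))
        (2 * ‖f s‖ ^ 2 * Real.exp (2 * a * (s - t₀)) * ((f' s / f s).re + a)) s := by
    have h := (hf s hs).norm_sq.mul
      ((((hasDerivAt_id s).sub_const t₀).const_mul (2 * a)).exp)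
    refine h.congr_deriv ?_
    rw [Complex.inner_eq_norm_sq_mul_re_div (hf₀ s hs)]
    simp only [id]
    ring
  have hmono : MonotoneOn (fun s ↦ ‖f s‖ ^ 2 * Real.exp (2 * a * (s - t₀))) (Set.Ici t₀) := by
    refine monotoneOn_of_deriv_nonneg (convex_Ici t₀)
      (fun s hs ↦ (hderiv s hs).continuousAt.continuousWithinAt)
      (fun s hs ↦ (hderiv s (interior_subset hs)).differentiableAt.differentiableWithinAt)
      fun s hs ↦ ?_
    have hs' : t₀ ≤ s := interior_subset hs
    rw [(hderiv s hs').deriv]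
    exact mul_nonneg (by positivity) (by linarith [hre s hs'])
  have h : ‖f t₀‖ ^ 2 ≤ ‖f t‖ ^ 2 * Real.exp (2 * a * (t - t₀)) := by
    simpa using hmono Set.self_mem_Ici ht ht
  have hexp : Real.exp (2 * a * (t - t₀)) = Real.exp (a * (t - t₀)) ^ 2 := by
    rw [← Real.exp_nat_mul]
    congr 1
    push_cast
    ring
  rw [hexp, ← mul_pow] at h
  rw [neg_mul, Real.exp_neg, ← div_eq_mul_inv, div_le_iff₀ (Real.exp_pos _)]
  exact (sq_le_sq₀ (by positivity) (by positivity)).1 h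

/-- Exponential lower bound on the vector field along a trajectory of
`ẋ = p(x)` near a singular point `x₀`: if `Re(p(z)/(z − x₀)) > −a` and
`|p(z)| ≥ c·|z − x₀|^(k+1)` on the punctured disk of radius `δ` around `x₀`, and the
trajectory stays in that punctured disk for `t ≥ t₀`, then
`|p(x(t))| ≥ c·|x(t₀) − x₀|^(k+1)·exp(−(k+1)a(t − t₀))`. -/
theorem vector_field_exponential_lower_bound_along_trajectory
    (p : ℂ → ℂ) (hp : Continuous p) (x₀ : ℂ) (a δ c : ℝ) (k : ℕ)
    (ha : 0 < a) (hδ : 0 < δ) (hc : 0 < c)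
    (hre : ∀ z : ℂ, 0 < ‖z - x₀‖ → ‖z - x₀‖ < δ → -a < (p z / (z - x₀)).re)
    (hlow : ∀ z : ℂ, 0 < ‖z - x₀‖ → ‖z - x₀‖ < δ → c * ‖z - x₀‖ ^ (k + 1) ≤ ‖p z‖)
    (t₀ : ℝ) (x : ℝ → ℂ)
    (hx : ∀ t, t₀ ≤ t → HasDerivAt x (p (x t)) t)
    (hxin : ∀ t, t₀ ≤ t → 0 < ‖x t - x₀‖ ∧ ‖x t - x₀‖ < δ) :
    ∀ t, t₀ ≤ t →
      c * ‖x t₀ - x₀‖ ^ (k + 1) * Real.exp (-((k + 1 : ℝ)) * a * (t - t₀)) ≤ ‖p (x t)‖ := by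
  intro t ht
  have hdecay : ‖x t₀ - x₀‖ * Real.exp (-a * (t - t₀)) ≤ ‖x t - x₀‖ :=
    Complex.norm_mul_exp_le_norm_of_neg_le_re_div (f := fun s ↦ x s - x₀)
      (fun s hs ↦ (hx s hs).sub_const x₀) (fun s hs ↦ norm_pos_iff.1 (hxin s hs).1)
      (fun s hs ↦ (hre _ (hxin s hs).1 (hxin s hs).2).le) ht
  have hexp : Real.exp (-((k + 1 : ℝ)) * a * (t - t₀)) =
      Real.exp (-a * (t - t₀)) ^ (k + 1) := by
    rw [← Real.exp_nat_mul]
    congr 1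
    push_cast
    ring
  calc c * ‖x t₀ - x₀‖ ^ (k + 1) * Real.exp (-((k + 1 : ℝ)) * a * (t - t₀))
      = c * (‖x t₀ - x₀‖ * Real.exp (-a * (t - t₀))) ^ (k + 1) := by
        rw [hexp, mul_pow, mul_assoc]
    _ ≤ c * ‖x t - x₀‖ ^ (k + 1) := by gcongr
    _ ≤ ‖p (x t)‖ := hlow _ (hxin t ht).1 (hxin t ht).2
end

section
/- Lower bound on the reciprocals of the derivative at the roots of the unfolded polynomial: fix k ≥ 1 and for ε = (ε₀,…,ε_{k−1}) ∈ ℂᵏ let p_ε(x) = x^{k+1} + ε_{k−1}x^{k−1} + ⋯ + ε₁x + ε₀ and ‖ε‖ = max_{0 ≤ j ≤ k−1} |ε_j|^{1/(k+1−j)}. If ε ≠ 0 and p_ε has k+1 distinct roots x₁,…,x_{k+1}, then for each root, |1/p′_ε(x_ℓ)| ≥ (4‖ε‖)^{−k}. -/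
/-- The generic unfolding `p_ε(x) = x^(k+1) + ε_{k−1} x^(k−1) + ⋯ + ε₁ x + ε₀`
of the polynomial `x^(k+1)`. -/
noncomputable def unfoldedPoly (k : ℕ) (ε : Fin k → ℂ) : Polynomial ℂ :=
  Polynomial.X ^ (k + 1) + ∑ j : Fin k, Polynomial.C (ε j) * Polynomial.X ^ (j : ℕ)

/-- The norm `‖ε‖ = max_{0 ≤ j ≤ k−1} |ε_j|^(1/(k+1−j))` in parameter space. -/
noncomputable def epsNorm (k : ℕ) (hk : 1 ≤ k) (ε : Fin k → ℂ) : ℝ :=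
  Finset.univ.sup' ⟨⟨0, hk⟩, Finset.mem_univ _⟩
    fun j : Fin k => ‖ε j‖ ^ ((1 : ℝ) / ((k + 1 - (j : ℕ) : ℕ) : ℝ))

open Polynomial in
theorem degree_sum_C_mul_X_pow_lt_succ (k : ℕ) (ε : Fin k → ℂ) :
    (∑ j : Fin k, C (ε j) * X ^ (j : ℕ)).degree < ((k + 1 : ℕ) : WithBot ℕ) := by
  refine (degree_sum_le _ _).trans_lt ?_
  refine (Finset.sup_lt_iff (WithBot.bot_lt_coe _)).2 fun j _ ↦ ?_
  exact (degree_C_mul_X_pow_le _ _).trans_lt (by exact_mod_cast (by omega : (j : ℕ) < k + 1))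

theorem unfoldedPoly_monic (k : ℕ) (ε : Fin k → ℂ) : (unfoldedPoly k ε).Monic :=
  Polynomial.monic_X_pow_add (degree_sum_C_mul_X_pow_lt_succ k ε)

open Polynomial in
theorem unfoldedPoly_natDegree (k : ℕ) (ε : Fin k → ℂ) :
    (unfoldedPoly k ε).natDegree = k + 1 := by
  refine natDegree_eq_of_degree_eq_some ?_
  unfold unfoldedPoly
  rw [degree_add_eq_left_of_degree_lt, degree_X_pow]
  rw [degree_X_pow]
  exact degree_sum_C_mul_X_pow_lt_succ k ε

theorem epsNorm_nonneg (k : ℕ) (hk : 1 ≤ k) (ε : Fin k → ℂ) : 0 ≤ epsNorm k hk ε :=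
  (Real.rpow_nonneg (norm_nonneg (ε ⟨0, hk⟩)) _).trans
    (Finset.le_sup' (fun j : Fin k ↦ ‖ε j‖ ^ ((1 : ℝ) / ((k + 1 - (j : ℕ) : ℕ) : ℝ)))
      (Finset.mem_univ _))

theorem norm_le_epsNorm_pow (k : ℕ) (hk : 1 ≤ k) (ε : Fin k → ℂ) (j : Fin k) :
    ‖ε j‖ ≤ epsNorm k hk ε ^ (k + 1 - (j : ℕ)) := by
  have h : ‖ε j‖ ^ ((1 : ℝ) / ((k + 1 - (j : ℕ) : ℕ) : ℝ)) ≤ epsNorm k hk ε :=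
    Finset.le_sup' (fun j : Fin k ↦ ‖ε j‖ ^ ((1 : ℝ) / ((k + 1 - (j : ℕ) : ℕ) : ℝ)))
      (Finset.mem_univ j)
  refine le_trans (le_of_eq ?_) (pow_le_pow_left₀ (by positivity) h _)
  rw [one_div, Real.rpow_inv_natCast_pow (norm_nonneg _) (by omega)]

theorem sum_pow_mul_pow_lt_pow {M t : ℝ} (hM : 0 ≤ M) (h : 2 * M < t) (k : ℕ) :
    ∑ j ∈ Finset.range k, M ^ (k + 1 - j) * t ^ j < t ^ (k + 1) := by
  have ht : 0 < t := by linarith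
  induction k with
  | zero => simpa using ht
  | succ k ih =>
    have hsum : ∑ j ∈ Finset.range k, M ^ (k + 1 + 1 - j) * t ^ j =
        M * ∑ j ∈ Finset.range k, M ^ (k + 1 - j) * t ^ j := by
      rw [Finset.mul_sum]
      refine Finset.sum_congr rfl fun j hj ↦ ?_
      rw [Nat.succ_sub (by have := Finset.mem_range.1 hj; omega : j ≤ k + 1), pow_succ]
      ring
    rw [Finset.sum_range_succ, hsum, show k + 1 + 1 - k = 2 by omega]
    have h1 : M * ∑ j ∈ Finset.range k, M ^ (k + 1 - j) * t ^ j ≤ M * t ^ (k + 1) :=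
      mul_le_mul_of_nonneg_left ih.le hM
    have h2 : 0 < t ^ k * (t ^ 2 - M * t - M ^ 2) := mul_pos (by positivity) (by nlinarith)
    calc _ ≤ M * t ^ (k + 1) + M ^ 2 * t ^ k := by gcongr
      _ < t ^ (k + 1 + 1) := by linear_combination h2

theorem norm_le_of_eval_unfoldedPoly_eq_zero (k : ℕ) (hk : 1 ≤ k) (ε : Fin k → ℂ) {z : ℂ}
    (hz : Polynomial.eval z (unfoldedPoly k ε) = 0) : ‖z‖ ≤ 2 * epsNorm k hk ε := by
  by_contra! h
  have hlt := sum_pow_mul_pow_lt_pow (epsNorm_nonneg k hk ε) h k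
  rw [← Fin.sum_univ_eq_sum_range (fun j ↦ epsNorm k hk ε ^ (k + 1 - j) * ‖z‖ ^ j)] at hlt
  have hz' : z ^ (k + 1) = -∑ j : Fin k, ε j * z ^ (j : ℕ) := by
    rw [← sub_eq_zero, sub_neg_eq_add]
    simpa [unfoldedPoly, Polynomial.eval_finsetSum] using hz
  refine hlt.not_ge ?_
  rw [← norm_pow, hz', norm_neg]
  refine (norm_sum_le _ _).trans (Finset.sum_le_sum fun j _ ↦ ?_)
  rw [norm_mul, norm_pow]
  gcongr
  exact norm_le_epsNorm_pow k hk ε j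

theorem unfoldedPoly_eq_nodal (k : ℕ) (ε : Fin k → ℂ) (x : Fin (k + 1) → ℂ)
    (hinj : Function.Injective x)
    (hroot : ∀ ℓ, Polynomial.eval (x ℓ) (unfoldedPoly k ε) = 0) :
    unfoldedPoly k ε = Lagrange.nodal Finset.univ x := by
  refine Polynomial.eq_of_monic_of_dvd_of_natDegree_le Lagrange.nodal_monic
    (unfoldedPoly_monic k ε) ?_ ?_
  · refine Finset.prod_dvd_of_coprime ?_ fun i _ ↦ Polynomial.dvd_iff_isRoot.2 (hroot i)
    exact fun i _ j _ hij ↦ Polynomial.pairwise_coprime_X_sub_C hinj hij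
  · simp [unfoldedPoly_natDegree]

/-- If `ε ≠ 0` and `p_ε` has `k+1` distinct roots `x₁,…,x_{k+1}`, then
for each root `|1/p′_ε(x_ℓ)| ≥ (4‖ε‖)^(−k)`. -/
theorem unfoldedPoly_reciprocal_derivative_lower_bound
    (k : ℕ) (hk : 1 ≤ k) (ε : Fin k → ℂ) (hε : ε ≠ 0)
    (x : Fin (k + 1) → ℂ) (hinj : Function.Injective x)
    (hroot : ∀ ℓ, Polynomial.eval (x ℓ) (unfoldedPoly k ε) = 0) :
    ∀ ℓ : Fin (k + 1), ((4 * epsNorm k hk ε) ^ k)⁻¹ ≤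
      ‖1 / Polynomial.eval (x ℓ) (Polynomial.derivative (unfoldedPoly k ε))‖ := by
  intro ℓ
  rw [unfoldedPoly_eq_nodal k ε x hinj hroot,
    Lagrange.eval_nodal_derivative_eval_node_eq (Finset.mem_univ ℓ), Lagrange.eval_nodal,
    norm_div, norm_one, one_div, norm_prod]
  have hpos : 0 < ∏ i ∈ Finset.univ.erase ℓ, ‖x ℓ - x i‖ :=
    Finset.prod_pos fun i hi ↦
      norm_pos_iff.2 (sub_ne_zero.2 (hinj.ne (Finset.ne_of_mem_erase hi).symm))
  refine inv_anti₀ hpos ?_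
  have hle : ∏ i ∈ Finset.univ.erase ℓ, ‖x ℓ - x i‖ ≤
      ∏ _i ∈ Finset.univ.erase ℓ, (4 * epsNorm k hk ε) := by
    refine Finset.prod_le_prod (fun _ _ ↦ norm_nonneg _) fun i _ ↦ ?_
    linarith [norm_sub_le (x ℓ) (x i), norm_le_of_eval_unfoldedPoly_eq_zero k hk ε (hroot ℓ),
      norm_le_of_eval_unfoldedPoly_eq_zero k hk ε (hroot i)]
  simpa using hle
end

section
/- Levinson's theorem on asymptotic solutions: let n ≥ 1, let Λ₀ be a constant diagonal n×n complex matrix whose diagonal entries have pairwise distinct real parts, let Λ : [0,∞) → Matₙ(ℂ) be continuously differentiable, diagonal for every t, with Λ(t) → 0 as t → ∞ and ∫₀^∞ ‖(d/dt)Λ(t)‖ dt < ∞, and let P : [0,∞) → Matₙ(ℂ) be continuous with ∫₀^∞ ‖P(t)‖ dt < ∞. Write λ_ℓ(t) for the ℓ-th diagonal entry of Λ₀ + Λ(t). Then for each ℓ ∈ {1,…,n} there exist t₀ ∈ (0,∞) and a differentiable function φ_ℓ : [t₀,∞) → ℂⁿ satisfying φ_ℓ′(t) = (Λ₀ + Λ(t)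 + P(t))·φ_ℓ(t) for all t ≥ t₀, such that lim_{t→∞} φ_ℓ(t)·exp(−∫_{t₀}^{t} λ_ℓ(τ) dτ) = v_ℓ, where v_ℓ is a nonzero scalar multiple of the ℓ-th standard basis vector of ℂⁿ. -/
open Filter MeasureTheory

/-- `D` is a solution operator on `(a, ∞)` for the scalar equation `u' = μ u + f`, additive in `f`,
bounded from `L¹` to `L^∞`, and with values vanishing at infinity. -/
def IsSolutionOperator (μ : ℝ → ℂ) (a : ℝ) (D : (ℝ → ℂ) → ℝ → ℂ) : Prop :=
  (∀ f, Continuous f → IntegrableOn f (Set.Ioi a) →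
    Continuous (D f) ∧ (∀ t, ‖D f t‖ ≤ ∫ s in Set.Ioi a, ‖f s‖) ∧
    (∀ t, a < t → HasDerivAt (D f) (μ t * D f t + f t) t) ∧
    Tendsto (D f) atTop (nhds 0)) ∧
  ∀ f g, Continuous f → IntegrableOn f (Set.Ioi a) →
    Continuous g → IntegrableOn g (Set.Ioi a) → D (f - g) = D f - D g

theorem IsSolutionOperator.exists_of_decaying {μ A : ℝ → ℂ} (hA : ∀ t, HasDerivAt A (μ t) t)
    (a : ℝ) {δ : ℝ} (hδ : 0 < δ) (hμ : ∀ t, (μ t).re ≤ -δ) :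
    ∃ D, IsSolutionOperator μ a D := by
  have hAc : Continuous A := continuous_iff_continuousAt.2 fun t => (hA t).continuousAt
  have hre (t : ℝ) : HasDerivAt (fun t => (A t).re) (μ t).re t :=
    Complex.reCLM.hasFDerivAt.comp_hasDerivAt t (hA t)
  have hanti : Antitone fun t => (A t).re + δ * t := by
    have hd (t : ℝ) : HasDerivAt (fun t => (A t).re + δ * t) ((μ t).re + δ * 1) t :=
      (hre t).add ((hasDerivAt_id t).const_mul δ)
    refine antitone_of_deriv_nonpos (fun t => (hd t).differentiableAt) fun t => ?_
    rw [(hd t).deriv]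
    linarith [hμ t]
  have hexp {s t : ℝ} (hst : s ≤ t) : ‖Complex.exp (A t - A s)‖ ≤ Real.exp (-δ * (t - s)) := by
    rw [Complex.norm_exp, Complex.sub_re]
    have := hanti hst
    simp only at this
    exact Real.exp_le_exp.2 (by linarith)
  have hker {s t : ℝ} (hst : s ≤ t) : ‖Complex.exp (A t - A s)‖ ≤ 1 :=
    (hexp hst).trans (Real.exp_le_one_iff.2 (by nlinarith))
  refine ⟨fun f t => Complex.exp (A t) * ∫ s in a..max t a, Complex.exp (-A s) * f s, ?_, ?_⟩
  · intro f hf hfi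
    have hcont : Continuous fun s => Complex.exp (-A s) * f s := by fun_prop
    have hker_eq {t : ℝ} (ht : a ≤ t) :
        Complex.exp (A t) * ∫ s in a..max t a, Complex.exp (-A s) * f s =
          ∫ s in Set.Ioi a, (Set.Iic t).indicator (fun s => Complex.exp (A t - A s) * f s) s := by
      rw [setIntegral_indicator measurableSet_Iic, Set.Ioi_inter_Iic, max_eq_left ht,
        intervalIntegral.integral_of_le ht, ← integral_const_mul]
      refine integral_congr_ae (Eventually.of_forall fun s => ?_)
      simp only
      rw [sub_eq_add_neg, Complex.exp_add, mul_assoc]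
    have hbound (t s : ℝ) :
        ‖(Set.Iic t).indicator (fun s => Complex.exp (A t - A s) * f s) s‖ ≤ ‖f s‖ := by
      by_cases hs : s ≤ t
      · rw [Set.indicator_of_mem (Set.mem_Iic.2 hs), norm_mul]
        exact mul_le_of_le_one_left (norm_nonneg _) (hker hs)
      · rw [Set.indicator_of_notMem (by simpa using hs)]
        simp
    refine ⟨?_, ?_, ?_, ?_⟩
    · exact (Complex.continuous_exp.comp hAc).mul
        ((intervalIntegral.continuous_primitive (fun _ _ => hcont.intervalIntegrable _ _) a).comp
          (continuous_id.max continuous_const))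
    · intro t
      rcases le_total a t with ht | ht
      · simp only
        rw [hker_eq ht]
        exact norm_integral_le_of_norm_le hfi.norm (Eventually.of_forall (hbound t))
      · simp only [max_eq_right ht, intervalIntegral.integral_same, mul_zero, norm_zero]
        positivity
    · intro t ht
      have h1 : HasDerivAt (fun t => ∫ s in a..t, Complex.exp (-A s) * f s)
          (Complex.exp (-A t) * f t) t :=
        (hcont.integral_hasStrictDerivAt _ t).hasDerivAt
      have h2 := (hA t).cexp.mul h1
      have h3 : (fun t => Complex.exp (A t) * ∫ s in a..max t a, Complex.exp (-A s) * f s) =ᶠ[nhds t]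
          fun t => Complex.exp (A t) * ∫ s in a..t, Complex.exp (-A s) * f s := by
        filter_upwards [lt_mem_nhds ht] with u hu
        rw [max_eq_left hu.le]
      refine (h2.congr_of_eventuallyEq h3).congr_deriv ?_
      have h4 : Complex.exp (A t) * Complex.exp (-A t) = 1 := by
        rw [← Complex.exp_add, add_neg_cancel, Complex.exp_zero]
      simp only [max_eq_left ht.le]
      linear_combination f t * h4
    · have key : Tendsto (fun t => ∫ s in Set.Ioi a,
          (Set.Iic t).indicator (fun s => Complex.exp (A t - A s) * f s) s) atTop
          (nhds (∫ _ in Set.Ioi a, (0 : ℂ))) := by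
        refine tendsto_integral_filter_of_dominated_convergence (fun s => ‖f s‖) ?_ ?_ hfi.norm ?_
        · refine Eventually.of_forall fun t => ?_
          refine (Continuous.aestronglyMeasurable ?_).indicator measurableSet_Iic
          fun_prop
        · exact Eventually.of_forall fun t => Eventually.of_forall (hbound t)
        · refine Eventually.of_forall fun s => ?_
          have h0 : Tendsto (fun t : ℝ => Real.exp (-δ * (t - s)) * ‖f s‖) atTop (nhds 0) := by
            have : Tendsto (fun t : ℝ => -δ * (t - s)) atTop atBot :=
              (tendsto_atTop_add_const_right atTop (-s) tendsto_id).const_mul_atTop_of_neg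
                (neg_lt_zero.2 hδ)
            simpa using (Real.tendsto_exp_atBot.comp this).mul_const ‖f s‖
          refine squeeze_zero_norm' ?_ h0
          filter_upwards [eventually_ge_atTop s] with t ht
          rw [Set.indicator_of_mem (Set.mem_Iic.2 ht), norm_mul]
          exact mul_le_mul_of_nonneg_right (hexp ht) (norm_nonneg _)
      rw [integral_zero] at key
      refine key.congr' ?_
      filter_upwards [eventually_ge_atTop a] with t ht
      exact (hker_eq ht).symm
  · intro f g hf _ hg _
    funext t
    have hfc : Continuous fun s => Complex.exp (-A s) * f s := by fun_prop
    have hgc : Continuous fun s => Complex.exp (-A s) * g s := by fun_prop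
    simp only [Pi.sub_apply, mul_sub]
    rw [intervalIntegral.integral_sub (hfc.intervalIntegrable _ _) (hgc.intervalIntegrable _ _),
      mul_sub]

theorem IsSolutionOperator.exists_of_nondecaying {μ A : ℝ → ℂ} (hA : ∀ t, HasDerivAt A (μ t) t)
    (a : ℝ) (hμ : ∀ t, 0 ≤ (μ t).re) :
    ∃ D, IsSolutionOperator μ a D := by
  have hAc : Continuous A := continuous_iff_continuousAt.2 fun t => (hA t).continuousAt
  have hre (t : ℝ) : HasDerivAt (fun t => (A t).re) (μ t).re t :=
    Complex.reCLM.hasFDerivAt.comp_hasDerivAt t (hA t)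
  have hmono : Monotone fun t => (A t).re := by
    refine monotone_of_deriv_nonneg (fun t => (hre t).differentiableAt) fun t => ?_
    rw [(hre t).deriv]
    exact hμ t
  have hker {s t : ℝ} (hst : t ≤ s) : ‖Complex.exp (A t - A s)‖ ≤ 1 := by
    rw [Complex.norm_exp, Complex.sub_re]
    exact Real.exp_le_one_iff.2 (sub_nonpos.2 (hmono hst))
  have hinteg {f : ℝ → ℂ} (hf : Continuous f) (hfi : IntegrableOn f (Set.Ioi a)) :
      IntegrableOn (fun s => Complex.exp (-A s) * f s) (Set.Ioi a) := by
    refine Integrable.bdd_mul (c := Real.exp (-(A a).re)) hfi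
      (Continuous.aestronglyMeasurable (by fun_prop)) ?_
    filter_upwards [ae_restrict_mem measurableSet_Ioi] with s hs
    rw [Complex.norm_exp, Complex.neg_re]
    exact Real.exp_le_exp.2 (neg_le_neg (hmono (le_of_lt hs)))
  have hsub (t : ℝ) : Set.Ioi (max t a) ⊆ Set.Ioi a := Set.Ioi_subset_Ioi (le_max_right _ _)
  refine ⟨fun f t => -(Complex.exp (A t) * ∫ s in Set.Ioi (max t a), Complex.exp (-A s) * f s),
    ?_, ?_⟩
  · intro f hf hfi
    have hcont : Continuous fun s => Complex.exp (-A s) * f s := by fun_prop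
    have hsplit {t : ℝ} (ht : a ≤ t) : ∫ s in Set.Ioi t, Complex.exp (-A s) * f s =
        (∫ s in Set.Ioi a, Complex.exp (-A s) * f s) -
          ∫ s in a..t, Complex.exp (-A s) * f s := by
      rw [← intervalIntegral.integral_interval_add_Ioi (hinteg hf hfi)
        ((hinteg hf hfi).mono_set (Set.Ioi_subset_Ioi ht))]
      ring
    have hbound (t : ℝ) :
        ‖-(Complex.exp (A t) * ∫ s in Set.Ioi (max t a), Complex.exp (-A s) * f s)‖ ≤
          ∫ s in Set.Ioi (max t a), ‖f s‖ := by
      rw [norm_neg, ← integral_const_mul]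
      refine norm_integral_le_of_norm_le (hfi.mono_set (hsub t)).norm ?_
      filter_upwards [ae_restrict_mem measurableSet_Ioi] with s hs
      rw [← mul_assoc, ← Complex.exp_add, ← sub_eq_add_neg, norm_mul]
      exact mul_le_of_le_one_left (norm_nonneg _)
        (hker ((le_max_left t a).trans (le_of_lt hs)))
    refine ⟨?_, ?_, ?_, ?_⟩
    · simp only [hsplit (le_max_right _ a)]
      exact ((Complex.continuous_exp.comp hAc).mul (continuous_const.sub
        ((intervalIntegral.continuous_primitive (fun _ _ => hcont.intervalIntegrable _ _) a).comp
          (continuous_id.max continuous_const)))).neg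
    · intro t
      exact (hbound t).trans (setIntegral_mono_set hfi.norm
        (Eventually.of_forall fun s => norm_nonneg (f s)) (hsub t).eventuallyLE)
    · intro t ht
      have h1 : HasDerivAt (fun t => ∫ s in a..t, Complex.exp (-A s) * f s)
          (Complex.exp (-A t) * f t) t :=
        (hcont.integral_hasStrictDerivAt _ t).hasDerivAt
      have h2 := ((hA t).cexp.mul
        (h1.const_sub (∫ s in Set.Ioi a, Complex.exp (-A s) * f s))).neg
      have h3 : (fun t => -(Complex.exp (A t) *
            ∫ s in Set.Ioi (max t a), Complex.exp (-A s) * f s)) =ᶠ[nhds t]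
          fun t => -(Complex.exp (A t) * ((∫ s in Set.Ioi a, Complex.exp (-A s) * f s) -
            ∫ s in a..t, Complex.exp (-A s) * f s)) := by
        filter_upwards [lt_mem_nhds ht] with u hu
        rw [max_eq_left hu.le, hsplit hu.le]
      refine (h2.congr_of_eventuallyEq h3).congr_deriv ?_
      have h4 : Complex.exp (A t) * Complex.exp (-A t) = 1 := by
        rw [← Complex.exp_add, add_neg_cancel, Complex.exp_zero]
      simp only [max_eq_left ht.le, hsplit ht.le]
      linear_combination f t * h4
    · exact squeeze_zero_norm hbound (tendsto_integral_Ioi_zero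
        (tendsto_atTop_mono (fun t => le_max_left t a) tendsto_id))
  · intro f g hf hfi hg hgi
    funext t
    simp only [Pi.sub_apply, mul_sub]
    rw [integral_sub ((hinteg hf hfi).mono_set (hsub t)) ((hinteg hg hgi).mono_set (hsub t))]
    ring

/-- A linear system `w' = diag(μ) w + Q w` with `Q` small in `L¹` and `μ ℓ = 0` has a solution
converging to the `ℓ`-th standard basis vector, provided each real part `Re μ i` is either bounded
above by a negative constant or nonnegative. -/
theorem exists_solution_tendsto_single {ι : Type*} [Fintype ι] [DecidableEq ι]
    {μ : ι → ℝ → ℂ} (hμc : ∀ i, Continuous (μ i))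
    (hμ : ∀ i, (∃ δ > 0, ∀ t, (μ i t).re ≤ -δ) ∨ ∀ t, 0 ≤ (μ i t).re)
    {ℓ : ι} (hℓ : ∀ t, μ ℓ t = 0) {a : ℝ} {Q : ℝ → Matrix ι ι ℂ}
    (hQc : ∀ i j, Continuous fun t => Q t i j)
    (hQi : ∀ i j, IntegrableOn (fun t => Q t i j) (Set.Ioi a))
    (hQ : ∀ i, ∑ j, ∫ s in Set.Ioi a, ‖Q s i j‖ ≤ 1 / 2) :
    ∃ w : ℝ → ι → ℂ,
      (∀ t, a < t → HasDerivAt w (fun i => μ i t * w t i + (Q t).mulVec (w t) i) t) ∧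
      Tendsto w atTop (nhds (Pi.single ℓ 1)) := by
  have hop (i : ι) : ∃ D, IsSolutionOperator (μ i) a D := by
    have hA (t : ℝ) : HasDerivAt (fun t => ∫ s in (0 : ℝ)..t, μ i s) (μ i t) t :=
      ((hμc i).integral_hasStrictDerivAt _ t).hasDerivAt
    rcases hμ i with ⟨δ, hδ, h⟩ | h
    · exact IsSolutionOperator.exists_of_decaying hA a hδ h
    · exact IsSolutionOperator.exists_of_nondecaying hA a h
  choose D hDop using hop
  have hD (i : ι) := (hDop i).1
  let F (w : BoundedContinuousFunction ℝ (ι → ℂ)) (i : ι) (s : ℝ) : ℂ := (Q s).mulVec (w s) i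
  have hwc (w : BoundedContinuousFunction ℝ (ι → ℂ)) (j : ι) : Continuous fun s => w s j :=
    (continuous_apply j).comp w.continuous
  have hwb (w : BoundedContinuousFunction ℝ (ι → ℂ)) (j : ι) (s : ℝ) : ‖w s j‖ ≤ ‖w‖ :=
    (norm_le_pi_norm (w s) j).trans (w.norm_coe_le_norm s)
  have hFc (w) (i) : Continuous (F w i) :=
    continuous_finsetSum _ fun j _ => (hQc i j).mul (hwc w j)
  have hFi (w) (i) : IntegrableOn (F w i) (Set.Ioi a) :=
    integrable_finsetSum _ fun j _ => (hQi i j).mul_bdd (c := ‖w‖)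
      (hwc w j).aestronglyMeasurable (Eventually.of_forall (hwb w j))
  have hFn (w) (i) : ∫ s in Set.Ioi a, ‖F w i s‖ ≤ 1 / 2 * ‖w‖ := by
    calc ∫ s in Set.Ioi a, ‖F w i s‖
        ≤ ∫ s in Set.Ioi a, ∑ j, ‖Q s i j‖ * ‖w‖ := by
          refine integral_mono (hFi w i).norm
            (integrable_finsetSum _ fun j _ => (hQi i j).norm.mul_const _) fun s => ?_
          refine (norm_sum_le _ _).trans (Finset.sum_le_sum fun j _ => ?_)
          rw [norm_mul]
          exact mul_le_mul_of_nonneg_left (hwb w j s) (norm_nonneg _)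
      _ = (∑ j, ∫ s in Set.Ioi a, ‖Q s i j‖) * ‖w‖ := by
          rw [integral_finsetSum _ fun j _ => (hQi i j).norm.mul_const _, Finset.sum_mul]
          exact Finset.sum_congr rfl fun j _ => integral_mul_const _ _
      _ ≤ 1 / 2 * ‖w‖ := mul_le_mul_of_nonneg_right (hQ i) (norm_nonneg _)
  have hDn (w) (i) (t) : ‖D i (F w i) t‖ ≤ 1 / 2 * ‖w‖ :=
    ((hD i _ (hFc w i) (hFi w i)).2.1 t).trans (hFn w i)
  let e : ι → ℂ := Pi.single ℓ 1
  let T (w : BoundedContinuousFunction ℝ (ι → ℂ)) : BoundedContinuousFunction ℝ (ι → ℂ) :=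
    BoundedContinuousFunction.ofNormedAddCommGroup (fun t => e + fun i => D i (F w i) t)
      (continuous_const.add (continuous_pi fun i => (hD i _ (hFc w i) (hFi w i)).1))
      (‖e‖ + 1 / 2 * ‖w‖) (fun t => by
        refine norm_add_le_of_le le_rfl ?_
        exact (pi_norm_le_iff_of_nonneg (by positivity)).2 fun i => hDn w i t)
  have hT : ContractingWith (1 / 2) T := by
    refine ⟨by norm_num, LipschitzWith.of_dist_le_mul fun w z => ?_⟩
    rw [dist_eq_norm w z, BoundedContinuousFunction.dist_le (by positivity)]
    intro t
    rw [dist_eq_norm, show T w t - T z t = fun i => D i (F w i) t - D i (F z i) t from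
      add_sub_add_left_eq_sub _ _ _, pi_norm_le_iff_of_nonneg (by positivity)]
    intro i
    have h1 : F w i - F z i = F (w - z) i := by
      funext s
      exact (congrFun (Matrix.mulVec_sub (Q s) (w s) (z s)) i).symm
    have h2 := congrFun ((hDop i).2 _ _ (hFc w i) (hFi w i) (hFc z i) (hFi z i)) t
    rw [h1, Pi.sub_apply] at h2
    rw [← h2]
    simpa using hDn (w - z) i t
  obtain ⟨w, hw⟩ : ∃ w, T w = w := ⟨_, hT.fixedPoint_isFixedPt⟩
  have hwt : (w : ℝ → ι → ℂ) = fun t => e + fun i => D i (F w i) t := by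
    conv_lhs => rw [← hw]
    rfl
  refine ⟨w, fun t ht => ?_, ?_⟩
  · rw [hasDerivAt_pi]
    intro i
    have h1 := ((hD i _ (hFc w i) (hFi w i)).2.2.1 t ht).const_add (e i)
    have h2 : (fun t => w t i) = fun t => e i + D i (F w i) t := by
      funext t
      exact congrFun (congrFun hwt t) i
    have h3 : μ i t * e i = 0 := by
      by_cases h : i = ℓ
      · rw [h, hℓ, zero_mul]
      · simp [e, h]
    rw [h2, congrFun h2 t]
    refine h1.congr_deriv ?_
    rw [mul_add, h3, zero_add]
  · rw [hwt]
    have h : Tendsto (fun t => e + fun i => D i (F w i) t) atTop (nhds (e + 0)) :=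
      tendsto_const_nhds.add (tendsto_pi_nhds.2 fun i => (hD i _ (hFc w i) (hFi w i)).2.2.2)
    rwa [add_zero] at h

/-- Levinson's theorem on asymptotic solutions.  Let `Λ₀` be a
constant diagonal matrix whose diagonal entries `lam0 ℓ` have pairwise distinct real
parts; let `Λ(t) = diag(l₁(t),…,lₙ(t))` be continuously differentiable on `[0,∞)`
(with derivative `l'`), tending to `0` at `∞`, with `∫₀^∞ ‖Λ′(t)‖ dt < ∞`; and let
`P(t)` be continuous with `∫₀^∞ ‖P(t)‖ dt < ∞`.  Then for each `ℓ` there exist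
`t₀ > 0` and a solution `φ_ℓ` of `φ′ = (Λ₀ + Λ(t) + P(t))·φ` on `[t₀,∞)` with
`φ_ℓ(t)·exp(−∫_{t₀}^t (lam0 ℓ + l_ℓ(τ)) dτ) → v_ℓ`, a nonzero multiple of the `ℓ`-th
standard basis vector. -/
theorem levinson_asymptotic_solutions
    (n : ℕ) (hn : 1 ≤ n) (lam0 : Fin n → ℂ)
    (hdist : Function.Injective fun i : Fin n => (lam0 i).re)
    (l l' : Fin n → ℝ → ℂ)
    (hderiv : ∀ i : Fin n, ∀ t : ℝ, 0 ≤ t → HasDerivAt (l i) (l' i t) t)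
    (hl'cont : ∀ i : Fin n, ContinuousOn (l' i) (Set.Ici 0))
    (hl0 : ∀ i : Fin n, Tendsto (l i) atTop (nhds 0))
    (hl'int : ∀ i : Fin n, IntegrableOn (fun t => ‖l' i t‖) (Set.Ici 0))
    (P : ℝ → Matrix (Fin n) (Fin n) ℂ)
    (hPcont : ∀ i j : Fin n, ContinuousOn (fun t => P t i j) (Set.Ici 0))
    (hPint : ∀ i j : Fin n, IntegrableOn (fun t => ‖P t i j‖) (Set.Ici 0)) :
    ∀ ℓ : Fin n, ∃ t₀ : ℝ, 0 < t₀ ∧ ∃ φ : ℝ → Fin n → ℂ,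
      (∀ t : ℝ, t₀ ≤ t → HasDerivAt φ
        ((Matrix.diagonal lam0 + Matrix.diagonal (fun i => l i t) + P t).mulVec (φ t)) t) ∧
      ∃ c : ℂ, c ≠ 0 ∧
        Tendsto (fun t => Complex.exp (-∫ τ in t₀..t, (lam0 ℓ + l ℓ τ)) • φ t)
          atTop (nhds (c • (Pi.single ℓ 1 : Fin n → ℂ))) := by
  intro ℓ
  have hlc (i : Fin n) : ContinuousOn (l i) (Set.Ici 0) := fun t ht =>
    (hderiv i t ht).continuousAt.continuousWithinAt
  have hlim (i : Fin n) : Tendsto (fun t => (lam0 i + l i t - (lam0 ℓ + l ℓ t)).re) atTop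
      (nhds ((lam0 i).re - (lam0 ℓ).re)) := by
    have h := ((hl0 i).const_add (lam0 i)).sub ((hl0 ℓ).const_add (lam0 ℓ))
    simpa [Function.comp_def] using (Complex.continuous_re.tendsto _).comp h
  have hgap (i : Fin n) : ∃ b, (∃ δ > 0, ∀ t ≥ b, (lam0 i + l i t - (lam0 ℓ + l ℓ t)).re ≤ -δ) ∨
      ∀ t ≥ b, 0 ≤ (lam0 i + l i t - (lam0 ℓ + l ℓ t)).re := by
    rcases lt_trichotomy (lam0 i).re (lam0 ℓ).re with h | h | h
    · obtain ⟨b, hb⟩ := eventually_atTop.1 ((hlim i).eventually_lt_const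
        (show (lam0 i).re - (lam0 ℓ).re < -(((lam0 ℓ).re - (lam0 i).re) / 2) by linarith))
      exact ⟨b, Or.inl ⟨_, by linarith, fun t ht => (hb t ht).le⟩⟩
    · obtain rfl : i = ℓ := hdist h
      exact ⟨0, Or.inr fun t _ => by simp⟩
    · obtain ⟨b, hb⟩ := eventually_atTop.1 ((hlim i).eventually_const_lt (sub_pos.2 h))
      exact ⟨b, Or.inr fun t ht => (hb t ht).le⟩
  choose b hb using hgap
  have htail : ∀ᶠ a in atTop, ∀ i, ∑ j, ∫ s in Set.Ioi a, ‖P s i j‖ ≤ 1 / 2 := by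
    rw [eventually_all]
    intro i
    have h : Tendsto (fun a => ∑ j, ∫ s in Set.Ioi a, ‖P s i j‖) atTop
        (nhds (∑ _j : Fin n, (0 : ℝ))) :=
      tendsto_finsetSum _ fun j _ => tendsto_integral_Ioi_zero tendsto_id
    rw [Finset.sum_const_zero] at h
    exact h.eventually_le_const (by norm_num)
  obtain ⟨a, ha0, hab, haP⟩ := ((eventually_ge_atTop (0 : ℝ)).and
    ((eventually_all.2 fun i => eventually_ge_atTop (b i)).and htail)).exists
  have hmax {f : ℝ → ℂ} (hf : ContinuousOn f (Set.Ici 0)) : Continuous fun t => f (max t a) :=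
    hf.comp_continuous (by fun_prop) fun t => ha0.trans (le_max_right t a)
  have hlamc (i : Fin n) : Continuous fun t => lam0 i + l i (max t a) :=
    continuous_const.add (hmax (hlc i))
  have hPa {s : ℝ} (hs : s ∈ Set.Ioi a) : P (max s a) = P s := by
    rw [max_eq_left (le_of_lt hs)]
  obtain ⟨w, hw, hwlim⟩ := exists_solution_tendsto_single
    (μ := fun i t => lam0 i + l i (max t a) - (lam0 ℓ + l ℓ (max t a)))
    (fun i => (hlamc i).sub (hlamc ℓ))
    (fun i => (hb i).imp
      (fun ⟨δ, hδ, h⟩ => ⟨δ, hδ, fun t => h _ ((hab i).trans (le_max_right t a))⟩)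
      (fun h t => h _ ((hab i).trans (le_max_right t a))))
    (ℓ := ℓ) (fun t => sub_self _) (a := a) (Q := fun t => P (max t a))
    (fun i j => hmax (hPcont i j))
    (fun i j => by
      have h : IntegrableOn (fun t => ‖P t i j‖) (Set.Ioi a) :=
        (hPint i j).mono_set fun t ht => ha0.trans (le_of_lt ht)
      refine (integrable_norm_iff (hmax (hPcont i j)).aestronglyMeasurable).1 ?_
      exact h.congr_fun (fun s hs => by simp only [hPa hs]) measurableSet_Ioi)
    (fun i => by
      refine le_of_eq_of_le (Finset.sum_congr rfl fun j _ => ?_) (haP i)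
      exact setIntegral_congr_fun measurableSet_Ioi fun s hs => by simp only [hPa hs])
  have hE (t : ℝ) : HasDerivAt (fun t => ∫ τ in (a + 1)..t, (lam0 ℓ + l ℓ (max τ a)))
      (lam0 ℓ + l ℓ (max t a)) t :=
    ((hlamc ℓ).integral_hasStrictDerivAt _ t).hasDerivAt
  refine ⟨a + 1, by linarith,
    fun t => Complex.exp (∫ τ in (a + 1)..t, (lam0 ℓ + l ℓ (max τ a))) • w t, ?_, 1, one_ne_zero, ?_⟩
  · intro t ht
    have hat : a < t := by linarith
    refine ((hE t).cexp.smul (hw t hat)).congr_deriv ?_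
    funext i
    simp only [max_eq_left hat.le, Matrix.add_mulVec, Matrix.mulVec_smul, Pi.add_apply,
      Pi.smul_apply, smul_eq_mul, Matrix.mulVec_diagonal]
    ring
  · rw [one_smul]
    refine hwlim.congr' ?_
    filter_upwards [eventually_ge_atTop (a + 1)] with t ht
    have h : ∫ τ in (a + 1)..t, (lam0 ℓ + l ℓ (max τ a)) = ∫ τ in (a + 1)..t, (lam0 ℓ + l ℓ τ) := by
      refine intervalIntegral.integral_congr fun τ hτ => ?_
      rw [Set.uIcc_of_le ht] at hτ
      simp only [max_eq_left (show a ≤ τ by linarith [hτ.1])]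
    rw [h, smul_smul, ← Complex.exp_add, neg_add_cancel, Complex.exp_zero, one_smul]
end
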